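/- Let μ ∈ (0,1) be fixed and let B ≥ 1 be an integer. For λ ∈ (0,1) with λ ≠ μ set τ(λ) = λ(1−μ)/(μ(1−λ)) and f(λ) = (μ−λ)/(μ − λ·τ(λ)^B). Then f is strictly decreasing: for all λ₁, λ₂ ∈ (0,1) with λ₁ < λ₂, λ₁ ≠ μ and λ₂ ≠ μ, one has f(λ₂) < f(λ₁). -/

import Mathlib

/-- The empty-buffer probability in a form without the removable singularity at `lam = mu`. -/
lemma emptyProb_eq_inv_geom_sum {mu lam : ℝ} (hmu : mu ≠ 0) (hlam : lam ≠ 1) (hne : lam ≠ mu)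
    (B : ℕ) :
    (mu - lam) / (mu - lam * (lam * (1 - mu) / (mu * (1 - lam))) ^ B) =
      (1 + lam / (mu * (1 - lam)) *
        ∑ i ∈ Finset.range B, (lam * (1 - mu) / (mu * (1 - lam))) ^ i)⁻¹ := by
  have h1 : 1 - lam ≠ 0 := sub_ne_zero.mpr hlam.symm
  have h2 : mu - lam ≠ 0 := sub_ne_zero.mpr hne.symm
  set t := lam * (1 - mu) / (mu * (1 - lam)) with ht
  have h3 : 1 - t = (mu - lam) / (mu * (1 - lam)) := by
    rw [ht]
    field_simp
    ring
  have hden : mu - lam * t ^ B =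
      (mu - lam) * (1 + lam / (mu * (1 - lam)) * ∑ i ∈ Finset.range B, t ^ i) := by
    calc mu - lam * t ^ B = (mu - lam) + lam * (1 - t ^ B) := by ring
      _ = (mu - lam) + lam * ((1 - t) * ∑ i ∈ Finset.range B, t ^ i) := by
        rw [mul_neg_geom_sum]
      _ = _ := by
        rw [h3]
        ring
  rw [hden, div_mul_cancel_left₀ h2]

/-- Lemma 2 (core step): the empty-source-buffer probability
`π_s(0) = (μ−λ)/(μ − λ·τ(λ)^B)` is strictly decreasing in the packet generating rate `λ`. -/
theorem stmt7 (mu : ℝ) (hmu : mu ∈ Set.Ioo (0 : ℝ) 1) (B : ℕ) (hB : 1 ≤ B) :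
    ∀ lam1 lam2 : ℝ, lam1 ∈ Set.Ioo (0 : ℝ) 1 → lam2 ∈ Set.Ioo (0 : ℝ) 1 →
      lam1 < lam2 → lam1 ≠ mu → lam2 ≠ mu →
      (mu - lam2) / (mu - lam2 * (lam2 * (1 - mu) / (mu * (1 - lam2))) ^ B)
        < (mu - lam1) / (mu - lam1 * (lam1 * (1 - mu) / (mu * (1 - lam1))) ^ B) := by
  rintro a b ⟨ha0, ha1⟩ ⟨hb0, hb1⟩ hab ha hb
  obtain ⟨hm0, hm1⟩ := hmu
  rw [emptyProb_eq_inv_geom_sum hm0.ne' ha1.ne ha, emptyProb_eq_inv_geom_sum hm0.ne' hb1.ne hb]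
  have ha' : 0 < 1 - a := sub_pos.mpr ha1
  have hb' : 0 < 1 - b := sub_pos.mpr hb1
  have hm' : 0 < 1 - mu := sub_pos.mpr hm1
  have hodds : a / (mu * (1 - a)) < b / (mu * (1 - b)) := by
    gcongr
  have hratio : a * (1 - mu) / (mu * (1 - a)) ≤ b * (1 - mu) / (mu * (1 - b)) := by
    gcongr
  have hsum : ∑ i ∈ Finset.range B, (a * (1 - mu) / (mu * (1 - a))) ^ i ≤
      ∑ i ∈ Finset.range B, (b * (1 - mu) / (mu * (1 - b))) ^ i := by
    gcongr
  have hpos : 0 < ∑ i ∈ Finset.range B, (a * (1 - mu) / (mu * (1 - a))) ^ i :=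
    Finset.sum_pos (fun i _ => by positivity) (Finset.nonempty_range_iff.mpr (by lia))
  refine inv_strictAnti₀ (by positivity) ?_
  have := mul_lt_mul hodds hsum hpos (by positivity)
  linarith
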